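/- Let α be a real number with 0 < α < 1 and let k be an integer with k > 16^(1/α). Then for every positive integer n there exists a finite word s₁s₂⋯sₙ of length n over an alphabet of size k (i.e., a list of length n with entries in Fin k) with similarity coefficient at most α; that is, for all indices t and all ℓ ≥ 1 with t + 2ℓ ≤ n, every list w that is a common subsequence of the adjacent factors s_{t+1}⋯s_{t+ℓ} and s_{t+ℓ+1}⋯s_{t+2ℓ} has length at most α·ℓ. -/

import Mathlib

open Finset

/-- The finite set of words of length `n` over a finite alphabet. -/
noncomputable def wordsOfLength (A : Type*) [Finite A] (n : ℕ) : Finset (List A) :=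
  (List.finite_length_eq A n).toFinset

/-- `HasLongCommonSubseq α ℓ x y` says that `x` and `y` have a common subsequence of length
greater than `α * ℓ`. -/
def HasLongCommonSubseq {A : Type*} (α : ℝ) (ℓ : ℕ) (x y : List A) : Prop :=
  ∃ w : List A, w.Sublist x ∧ w.Sublist y ∧ α * ℓ < w.length

/-- A word is dissimilar at level `α` if its similarity coefficient is at most `α`. -/
def Dissimilar {A : Type*} (α : ℝ) (s : List A) : Prop :=
  ∀ t ℓ : ℕ, 1 ≤ ℓ → t + 2 * ℓ ≤ s.length →
    ¬ HasLongCommonSubseq α ℓ ((s.drop t).take ℓ) ((s.drop (t + ℓ)).take ℓ)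

open Classical in
/-- The finite set of words of length `n` with similarity coefficient at most `α`. -/
noncomputable def dissimilarWords (A : Type*) [Finite A] (α : ℝ) (n : ℕ) : Finset (List A) :=
  {s ∈ wordsOfLength A n | Dissimilar α s}

section

variable {A : Type*}

@[simp]
theorem mem_wordsOfLength [Finite A] {n : ℕ} {s : List A} :
    s ∈ wordsOfLength A n ↔ s.length = n := by
  simp [wordsOfLength]

theorem mem_dissimilarWords [Finite A] {α : ℝ} {n : ℕ} {s : List A} :
    s ∈ dissimilarWords A α n ↔ s.length = n ∧ Dissimilar α s := by
  simp [dissimilarWords]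

theorem Dissimilar.drop {α : ℝ} {s : List A} (h : Dissimilar α s) (j : ℕ) :
    Dissimilar α (s.drop j) := by
  intro t ℓ hℓ ht
  rw [List.length_drop] at ht
  have := h (j + t) ℓ hℓ (by omega)
  rwa [List.drop_drop, List.drop_drop, ← add_assoc]

/-- If prepending a letter destroys dissimilarity, then a prefix is responsible. -/
theorem Dissimilar.exists_prefix_of_not_cons {α : ℝ} {s : List A} {a : A}
    (hs : Dissimilar α s) (h : ¬ Dissimilar α (a :: s)) :
    ∃ ℓ, 1 ≤ ℓ ∧ 2 * ℓ ≤ s.length + 1 ∧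
      HasLongCommonSubseq α ℓ ((a :: s).take ℓ) (((a :: s).drop ℓ).take ℓ) := by
  unfold Dissimilar at h
  push Not at h
  obtain ⟨t, ℓ, hℓ, ht, hw⟩ := h
  rw [List.length_cons] at ht
  cases t with
  | zero => exact ⟨ℓ, hℓ, by omega, by simpa using hw⟩
  | succ t =>
    refine absurd ?_ (hs t ℓ hℓ (by omega))
    rwa [List.drop_succ_cons, show t + 1 + ℓ = (t + ℓ) + 1 by omega, List.drop_succ_cons] at hw

theorem card_image_cons [Fintype A] [DecidableEq (List A)] (S : Finset (List A)) :
    #((univ ×ˢ S).image fun p : A × List A => p.1 :: p.2) = Fintype.card A * #S := by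
  rw [card_image_of_injective, card_product, card_univ]
  rintro ⟨a, s⟩ ⟨b, t⟩ h
  simpa using h

theorem card_wordsOfLength [Fintype A] (n : ℕ) :
    #(wordsOfLength A n) = Fintype.card A ^ n := by
  classical
  induction n with
  | zero =>
    rw [show wordsOfLength A 0 = {[]} by ext; simp]
    simp
  | succ n ih =>
    rw [pow_succ', ← ih, ← card_image_cons]
    congr 1
    ext s
    cases s <;> simp

open Classical in
/-- Few words of length `ℓ` contain a given long subsequence. -/
theorem card_superlists_mul_le [Fintype A] (ℓ : ℕ) (w : List A) :
    #{x ∈ wordsOfLength A ℓ | w.Sublist x} * Fintype.card A ^ w.length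
      ≤ (2 * Fintype.card A) ^ ℓ := by
  induction ℓ generalizing w with
  | zero =>
    have h0 : wordsOfLength A 0 = {[]} := by ext; simp
    cases w <;> simp [h0, filter_singleton]
  | succ ℓ ih =>
    cases w with
    | nil =>
      simp only [List.nil_sublist, filter_true, card_wordsOfLength, List.length_nil, pow_zero,
        mul_one]
      exact Nat.pow_le_pow_left (by omega) _
    | cons b w =>
      have hsub : {x ∈ wordsOfLength A (ℓ + 1) | (b :: w).Sublist x} ⊆
          ((univ ×ˢ {x ∈ wordsOfLength A ℓ | (b :: w).Sublist x}).image
            fun p : A × List A => p.1 :: p.2) ∪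
          {x ∈ wordsOfLength A ℓ | w.Sublist x}.image (b :: ·) := by
        intro x hx
        simp only [mem_filter, mem_wordsOfLength] at hx
        obtain ⟨hl, hx⟩ := hx
        cases hx with
        | cons a h =>
          refine mem_union_left _ (mem_image.2 ⟨(a, _), ?_, rfl⟩)
          simpa [h] using hl
        | cons_cons a h =>
          refine mem_union_right _ (mem_image.2 ⟨_, ?_, rfl⟩)
          simpa [h] using hl
      have hcard := (card_le_card hsub).trans (card_union_le _ _)
      rw [card_image_cons] at hcard
      have hcard' := hcard.trans (Nat.add_le_add_left card_image_le _)
      calc _ ≤ _ := Nat.mul_le_mul_right _ hcard'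
        _ = Fintype.card A * (#{x ∈ wordsOfLength A ℓ | (b :: w).Sublist x} *
              Fintype.card A ^ (b :: w).length) +
            Fintype.card A * (#{x ∈ wordsOfLength A ℓ | w.Sublist x} *
              Fintype.card A ^ w.length) := by
          rw [List.length_cons]; ring
        _ ≤ Fintype.card A * (2 * Fintype.card A) ^ ℓ +
            Fintype.card A * (2 * Fintype.card A) ^ ℓ := by
          gcongr
          · exact ih _
          · exact ih _
        _ = _ := by ring

open Classical in
/-- Few words of length `ℓ` have a long common subsequence with a given word of length `ℓ`. -/
theorem card_hasLongCommonSubseq_mul_le [Fintype A] {α : ℝ}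
    (hA : ∀ ℓ m : ℕ, α * ℓ < m → 16 ^ ℓ ≤ Fintype.card A ^ m)
    (ℓ : ℕ) (y : List A) (hy : y.length ≤ ℓ) :
    #{x ∈ wordsOfLength A ℓ | HasLongCommonSubseq α ℓ x y} * 4 ^ ℓ ≤ Fintype.card A ^ ℓ := by
  set T : Finset (List A) := {w ∈ y.sublists.toFinset | α * ℓ < w.length} with hT
  have hTcard : #T ≤ 2 ^ ℓ := by
    calc #T ≤ #y.sublists.toFinset := card_filter_le _ _
      _ ≤ y.sublists.length := List.toFinset_card_le _
      _ = 2 ^ y.length := List.length_sublists y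
      _ ≤ 2 ^ ℓ := Nat.pow_le_pow_right (by norm_num) hy
  have hsub : {x ∈ wordsOfLength A ℓ | HasLongCommonSubseq α ℓ x y} ⊆
      T.biUnion fun w => {x ∈ wordsOfLength A ℓ | w.Sublist x} := by
    intro x hx
    obtain ⟨hl, w, hwx, hwy, hw⟩ := mem_filter.1 hx
    refine mem_biUnion.2 ⟨w, ?_, mem_filter.2 ⟨hl, hwx⟩⟩
    simp [hT, hwy, hw]
  have hbound : ∀ w ∈ T, #{x ∈ wordsOfLength A ℓ | w.Sublist x} * 8 ^ ℓ ≤ Fintype.card A ^ ℓ := by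
    intro w hw
    have h16 := hA ℓ w.length (mem_filter.1 hw).2
    have h := (Nat.mul_le_mul_left _ h16).trans (card_superlists_mul_le ℓ w)
    rw [show 16 = 2 * 8 by norm_num, mul_pow, mul_pow, mul_left_comm] at h
    exact Nat.le_of_mul_le_mul_left h (by positivity)
  have key : #{x ∈ wordsOfLength A ℓ | HasLongCommonSubseq α ℓ x y} * 8 ^ ℓ
      ≤ 2 ^ ℓ * Fintype.card A ^ ℓ := by
    calc _ ≤ (∑ w ∈ T, #{x ∈ wordsOfLength A ℓ | w.Sublist x}) * 8 ^ ℓ :=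
          Nat.mul_le_mul_right _ ((card_le_card hsub).trans card_biUnion_le)
      _ = ∑ w ∈ T, #{x ∈ wordsOfLength A ℓ | w.Sublist x} * 8 ^ ℓ := sum_mul _ _ _
      _ ≤ #T * Fintype.card A ^ ℓ := sum_le_card_nsmul _ _ _ hbound
      _ ≤ _ := Nat.mul_le_mul_right _ hTcard
  rw [show 8 = 2 * 4 by norm_num, mul_pow, mul_left_comm] at key
  exact Nat.le_of_mul_le_mul_left key (by positivity)

open Classical in
/-- Few words consist of a dissimilar word preceded by a block of length `ℓ` that is too similar
to the block following it. -/
theorem card_similar_prefix_mul_le [Fintype A] {α : ℝ}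
    (hA : ∀ ℓ m : ℕ, α * ℓ < m → 16 ^ ℓ ≤ Fintype.card A ^ m) (m ℓ : ℕ) :
    #{z ∈ wordsOfLength A (ℓ + m) | z.drop ℓ ∈ dissimilarWords A α m ∧
        HasLongCommonSubseq α ℓ (z.take ℓ) ((z.drop ℓ).take ℓ)} * 4 ^ ℓ
      ≤ Fintype.card A ^ ℓ * #(dissimilarWords A α m) := by
  have hle : #{z ∈ wordsOfLength A (ℓ + m) | z.drop ℓ ∈ dissimilarWords A α m ∧
        HasLongCommonSubseq α ℓ (z.take ℓ) ((z.drop ℓ).take ℓ)} ≤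
      #((dissimilarWords A α m).sigma fun y =>
        {x ∈ wordsOfLength A ℓ | HasLongCommonSubseq α ℓ x (y.take ℓ)}) := by
    refine card_le_card_of_injOn (fun z => ⟨z.drop ℓ, z.take ℓ⟩) ?_ ?_
    · intro z hz
      obtain ⟨hl, hd, hw⟩ := mem_filter.1 hz
      rw [mem_wordsOfLength] at hl
      exact mem_sigma.2 ⟨hd, mem_filter.2 ⟨by simp [hl], hw⟩⟩
    · intro z _ z' _ h
      simp only [Sigma.mk.injEq, heq_eq_eq] at h
      rw [← List.take_append_drop ℓ z, h.1, h.2, List.take_append_drop]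
  rw [card_sigma] at hle
  calc _ ≤ _ := Nat.mul_le_mul_right _ hle
    _ = _ := sum_mul _ _ _
    _ ≤ #(dissimilarWords A α m) * Fintype.card A ^ ℓ :=
      sum_le_card_nsmul _ _ _ fun y _ =>
        card_hasLongCommonSubseq_mul_le hA ℓ (y.take ℓ) (by simp)
    _ = _ := mul_comm _ _

open Classical in
/-- Every one-letter extension of a dissimilar word is dissimilar or has a similar prefix. -/
theorem card_mul_card_dissimilarWords_le [Fintype A] (α : ℝ) (n : ℕ) :
    Fintype.card A * #(dissimilarWords A α n) ≤ #(dissimilarWords A α (n + 1)) +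
      ∑ j ∈ range n, #{z ∈ wordsOfLength A (j + 1 + (n - j)) |
        z.drop (j + 1) ∈ dissimilarWords A α (n - j) ∧
        HasLongCommonSubseq α (j + 1) (z.take (j + 1)) ((z.drop (j + 1)).take (j + 1))} := by
  rw [← card_image_cons]
  refine (card_le_card (t := dissimilarWords A α (n + 1) ∪ (range n).biUnion _) ?_).trans
    ((card_union_le _ _).trans (Nat.add_le_add_left card_biUnion_le _))
  intro z hz
  obtain ⟨⟨a, s⟩, hs, rfl⟩ := mem_image.1 hz
  obtain ⟨hl, hs⟩ := mem_dissimilarWords.1 (mem_product.1 hs).2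
  dsimp only at hl hs ⊢
  by_cases h : Dissimilar α (a :: s)
  · exact mem_union_left _ (mem_dissimilarWords.2 ⟨by simp [hl], h⟩)
  · obtain ⟨ℓ, hℓ, hℓn, hw⟩ := hs.exists_prefix_of_not_cons h
    obtain ⟨j, rfl⟩ := Nat.exists_eq_add_of_le' hℓ
    refine mem_union_right _ (mem_biUnion.2 ⟨j, mem_range.2 (by omega), mem_filter.2
      ⟨?_, ?_, hw⟩⟩)
    · rw [mem_wordsOfLength, List.length_cons]; omega
    · rw [List.drop_succ_cons]
      exact mem_dissimilarWords.2 ⟨by simp [hl], hs.drop j⟩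

/-- The number of dissimilar words grows at least by the factor `card A / 2`. -/
theorem card_mul_card_dissimilarWords_le_two_mul [Fintype A] {α : ℝ}
    (hA : ∀ ℓ m : ℕ, α * ℓ < m → 16 ^ ℓ ≤ Fintype.card A ^ m) (n : ℕ) :
    Fintype.card A * #(dissimilarWords A α n) ≤ 2 * #(dissimilarWords A α (n + 1)) := by
  classical
  induction n using Nat.strong_induction_on with
  | _ n ih =>
    set k := Fintype.card A
    have hpow : ∀ j ≤ n, k ^ j * #(dissimilarWords A α (n - j)) ≤
        2 ^ j * #(dissimilarWords A α n) := by
      intro j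
      induction j with
      | zero => simp
      | succ j ihj =>
        intro hj
        have h1 := ih (n - (j + 1)) (by omega)
        rw [show n - (j + 1) + 1 = n - j by omega] at h1
        have h2 := ihj (by omega)
        calc _ = k ^ j * (k * #(dissimilarWords A α (n - (j + 1)))) := by ring
          _ ≤ k ^ j * (2 * #(dissimilarWords A α (n - j))) := Nat.mul_le_mul_left _ h1
          _ = 2 * (k ^ j * #(dissimilarWords A α (n - j))) := by ring
          _ ≤ 2 * (2 ^ j * #(dissimilarWords A α n)) := Nat.mul_le_mul_left _ h2
          _ = _ := by ring
    have hext : (k : ℝ) * #(dissimilarWords A α n) ≤ #(dissimilarWords A α (n + 1)) +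
        ∑ j ∈ range n, (#{z ∈ wordsOfLength A (j + 1 + (n - j)) |
          z.drop (j + 1) ∈ dissimilarWords A α (n - j) ∧
          HasLongCommonSubseq α (j + 1) (z.take (j + 1)) ((z.drop (j + 1)).take (j + 1))} : ℝ) :=
      mod_cast card_mul_card_dissimilarWords_le α n
    have hterm : ∀ j ∈ range n, (#{z ∈ wordsOfLength A (j + 1 + (n - j)) |
          z.drop (j + 1) ∈ dissimilarWords A α (n - j) ∧
          HasLongCommonSubseq α (j + 1) (z.take (j + 1)) ((z.drop (j + 1)).take (j + 1))} : ℝ) ≤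
        (1 / 2) ^ j * (k * #(dissimilarWords A α n) / 4) := by
      intro j hj
      have h1 := card_similar_prefix_mul_le hA (n - j) (j + 1)
      have h2 := Nat.mul_le_mul_left k (hpow j (mem_range.1 hj).le)
      rw [← mul_assoc, ← pow_succ'] at h2
      have h3 : (_ : ℝ) ≤ _ := Nat.cast_le.2 (h1.trans h2)
      push_cast at h3
      rw [← le_div_iff₀ (by positivity)] at h3
      refine h3.trans_eq ?_
      rw [show (4 : ℝ) ^ (j + 1) = 2 ^ j * 2 ^ j * 4 by rw [← mul_pow]; norm_num [pow_succ],
        div_pow, one_pow]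
      field_simp
    have hgeom : ∑ j ∈ range n, ((1 : ℝ) / 2) ^ j ≤ 2 := sum_geometric_two_le n
    have hsum := sum_le_sum hterm
    rw [← sum_mul] at hsum
    have hnonneg : (0 : ℝ) ≤ k * #(dissimilarWords A α n) / 4 := by positivity
    have hmul := mul_le_mul_of_nonneg_right hgeom hnonneg
    have : (k : ℝ) * #(dissimilarWords A α n) ≤ 2 * #(dissimilarWords A α (n + 1)) := by
      linarith
    exact_mod_cast this

theorem dissimilarWords_nonempty [Fintype A] [Nonempty A] {α : ℝ}
    (hA : ∀ ℓ m : ℕ, α * ℓ < m → 16 ^ ℓ ≤ Fintype.card A ^ m) (n : ℕ) :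
    (dissimilarWords A α n).Nonempty := by
  induction n with
  | zero =>
    refine ⟨[], mem_dissimilarWords.2 ⟨rfl, fun t ℓ hℓ ht => ?_⟩⟩
    rw [List.length_nil] at ht
    omega
  | succ n ih =>
    have h := card_mul_card_dissimilarWords_le_two_mul hA n
    have hpos := Nat.mul_pos (Fintype.card_pos (α := A)) ih.card_pos
    exact card_pos.1 (by omega)

end

theorem sixteen_pow_le_pow {α : ℝ} (hα : 0 < α) {k : ℕ} (hk : (16 : ℝ) ^ (1 / α) < k)
    {ℓ m : ℕ} (h : α * ℓ < m) : 16 ^ ℓ ≤ k ^ m := by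
  have hk1 : (1 : ℝ) ≤ k :=
    (Real.one_le_rpow (by norm_num) (by positivity)).trans hk.le
  have : (16 : ℝ) ^ ℓ ≤ (k : ℝ) ^ m := by
    calc (16 : ℝ) ^ ℓ = ((16 : ℝ) ^ (1 / α)) ^ (α * ℓ) := by
          rw [← Real.rpow_mul (by norm_num), ← mul_assoc, one_div_mul_cancel hα.ne', one_mul,
            Real.rpow_natCast]
      _ ≤ (k : ℝ) ^ (α * ℓ) := Real.rpow_le_rpow (by positivity) hk.le (by positivity)
      _ ≤ (k : ℝ) ^ (m : ℝ) := Real.rpow_le_rpow_of_exponent_le hk1 h.le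
      _ = (k : ℝ) ^ m := Real.rpow_natCast _ _
  exact_mod_cast this

/-- For `0 < α < 1` and integer `k > 16^(1/α)`, for every positive integer `n` there is
a finite word of length `n` over a `k`-letter alphabet with similarity coefficient at
most `α`: every common subsequence of two adjacent equal-length contiguous factors of
common length `ℓ ≥ 1` has length at most `α·ℓ`. -/
theorem exists_finite_word_similarity_le
    (α : ℝ) (hα0 : 0 < α) (hα1 : α < 1)
    (k : ℕ) (hk : (16 : ℝ) ^ (1 / α) < (k : ℝ))
    (n : ℕ) (hn : 0 < n) :
    ∃ s : List (Fin k), s.length = n ∧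
      ∀ (t ℓ : ℕ), 1 ≤ ℓ → t + 2 * ℓ ≤ n →
        ∀ w : List (Fin k),
          w.Sublist ((s.drop t).take ℓ) →
          w.Sublist ((s.drop (t + ℓ)).take ℓ) →
          (w.length : ℝ) ≤ α * ℓ := by
  have hk0 : (0 : ℝ) < k := lt_of_le_of_lt (by positivity) hk
  have : NeZero k := ⟨by rintro rfl; simp at hk0⟩
  obtain ⟨s, hs⟩ := dissimilarWords_nonempty (A := Fin k) (α := α)
    (fun ℓ m h => by simpa using sixteen_pow_le_pow hα0 hk h) n
  obtain ⟨rfl, hdis⟩ := mem_dissimilarWords.1 hs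
  refine ⟨s, rfl, fun t ℓ hℓ ht w hx hy => ?_⟩
  by_contra hw
  exact hdis t ℓ hℓ ht ⟨w, hx, hy, not_le.1 hw⟩
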